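/- Let G be a simple graph on vertex set [n] with no isolated vertices and let I = I(G) ⊂ S = K[x_1,...,x_n] be its edge ideal. Then the following conditions are equivalent: (a) I^2 is of intersection type; (b) Ass(S/I^2) ⊂ Ass(S/I) ∪ {m}, where m = (x_1,...,x_n); (c) every 3-cycle of G is central. -/

import Mathlib

open MvPolynomial

noncomputable section

variable (K : Type) [Field K]

/-- The monomial prime ideal `p_F` generated by the variables `x_i`, `i ∈ F`. -/
def monomialPrimeIdeal {n : ℕ} (F : Finset (Fin n)) : Ideal (MvPolynomial (Fin n) K) :=
  Ideal.span ((fun i => (X i : MvPolynomial (Fin n) K)) '' F)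

/-- A monomial ideal: an ideal generated by monomials. -/
def IsMonomialIdeal {σ : Type*} (I : Ideal (MvPolynomial σ K)) : Prop :=
  ∃ A : Set (σ →₀ ℕ), I = Ideal.span ((fun u => (monomial u (1 : K))) '' A)

/-- The graded maximal ideal of a polynomial ring. -/
def maxIdeal (σ : Type*) : Ideal (MvPolynomial σ K) :=
  Ideal.span (Set.range (X : σ → MvPolynomial σ K))

/-- The monomial localization map `S → S(p_F)`, sending `x_i ↦ x_i` for `i ∈ F`
and `x_i ↦ 1` otherwise. -/
def monomialLocalizationMap {n : ℕ} (F : Finset (Fin n)) :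
    MvPolynomial (Fin n) K →+* MvPolynomial {i : Fin n // i ∈ F} K :=
  (aeval (fun i : Fin n =>
    if h : i ∈ F then (X ⟨i, h⟩ : MvPolynomial {i : Fin n // i ∈ F} K) else 1)).toRingHom

/-- The monomial localization `I(p_F) ⊆ S(p_F)` of a monomial ideal `I`. -/
def mLoc {n : ℕ} (I : Ideal (MvPolynomial (Fin n) K)) (F : Finset (Fin n)) :
    Ideal (MvPolynomial {i : Fin n // i ∈ F} K) :=
  I.map (monomialLocalizationMap K F)

/-- `min(J)`: the minimal degree of a nonzero homogeneous element of `J`, which for a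
graded ideal is the minimal degree of a generator. -/
def minGenDeg {σ : Type*} (J : Ideal (MvPolynomial σ K)) : ℕ :=
  sInf {d : ℕ | ∃ f ∈ J, f ≠ 0 ∧ MvPolynomial.IsHomogeneous f d}

/-- `max(Soc(S/J))`: the maximal degree of a nonzero homogeneous element of the
socle `(J : m)/J` of `S/J`. -/
def maxSocleDeg {σ : Type*} (J : Ideal (MvPolynomial σ K)) : ℕ :=
  sSup {d : ℕ | ∃ f : MvPolynomial σ K, f ∉ J ∧ MvPolynomial.IsHomogeneous f d ∧
    ∀ i : σ, X i * f ∈ J}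

/-- `I` is of intersection type: `I` is an intersection of (positive) powers of
monomial prime ideals. -/
def IsIntersectionType {n : ℕ} (I : Ideal (MvPolynomial (Fin n) K)) : Prop :=
  ∃ (r : ℕ) (F : Fin r → Finset (Fin n)) (d : Fin r → ℕ),
    (∀ i, 0 < d i) ∧ I = ⨅ i, (monomialPrimeIdeal K (F i)) ^ (d i)

/-- The edge ideal of a finite simple graph. -/
def edgeIdeal {V : Type*} (G : SimpleGraph V) : Ideal (MvPolynomial V K) :=
  Ideal.span {f : MvPolynomial V K | ∃ i j : V, G.Adj i j ∧ f = X i * X j}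

/-- `i, j, k` form a 3-cycle of `G`. -/
def IsThreeCycle {V : Type*} (G : SimpleGraph V) (i j k : V) : Prop :=
  G.Adj i j ∧ G.Adj j k ∧ G.Adj i k

/-- A 3-cycle of `G` is central if every vertex of `G` is a neighbor of one of its
vertices. -/
def IsCentralThreeCycle {V : Type*} (G : SimpleGraph V) (i j k : V) : Prop :=
  IsThreeCycle G i j k ∧ ∀ v : V, G.Adj v i ∨ G.Adj v j ∨ G.Adj v k

section MonomialPrimes

variable {n : ℕ}

/-- The substitution `x_i ↦ t x_i` for `i ∈ F`, `x_i ↦ x_i` for `i ∉ F`. -/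
def scaleHom (F : Finset (Fin n)) :
    MvPolynomial (Fin n) K →ₐ[K] Polynomial (MvPolynomial (Fin n) K) :=
  aeval fun i => Polynomial.C (X i) * if i ∈ F then Polynomial.X else 1

variable {K}

theorem scaleHom_monomial (F : Finset (Fin n)) (u : Fin n →₀ ℕ) (c : K) :
    scaleHom K F (monomial u c) = Polynomial.C (monomial u c) * Polynomial.X ^ ∑ i ∈ F, u i := by
  have hprod : ∏ i, (Polynomial.C (X i : MvPolynomial (Fin n) K) *
      if i ∈ F then Polynomial.X else 1) ^ u i =
      Polynomial.C (∏ i, (X i : MvPolynomial (Fin n) K) ^ u i) *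
        Polynomial.X ^ ∑ i ∈ F, u i := by
    simp_rw [mul_pow, Finset.prod_mul_distrib, map_prod, map_pow, ite_pow, one_pow]
    rw [Finset.prod_ite_mem, Finset.univ_inter, Finset.prod_pow_eq_pow_sum]
  rw [scaleHom, aeval_monomial, Finsupp.prod_fintype _ _ (by simp), hprod, monomial_eq,
    Finsupp.prod_fintype _ _ (by simp), map_mul, mul_assoc]
  rfl

theorem coeff_coeff_scaleHom (F : Finset (Fin n)) (f : MvPolynomial (Fin n) K) (k : ℕ)
    (u : Fin n →₀ ℕ) :
    ((scaleHom K F f).coeff k).coeff u = if k = ∑ i ∈ F, u i then f.coeff u else 0 := by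
  induction f using MvPolynomial.induction_on' with
  | monomial v c =>
    rw [scaleHom_monomial, Polynomial.coeff_C_mul_X_pow]
    by_cases huv : v = u
    · subst huv
      split_ifs <;> simp
    · split_ifs <;> simp [huv]
  | add p q hp hq =>
    rw [map_add, Polynomial.coeff_add, coeff_add, hp, hq]
    split_ifs <;> simp

theorem X_pow_dvd_scaleHom_iff (F : Finset (Fin n)) (f : MvPolynomial (Fin n) K) (d : ℕ) :
    Polynomial.X ^ d ∣ scaleHom K F f ↔ ∀ u ∈ f.support, d ≤ ∑ i ∈ F, u i := by
  rw [Polynomial.X_pow_dvd_iff]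
  constructor
  · intro h u hu
    by_contra! hlt
    have := coeff_coeff_scaleHom F f (∑ i ∈ F, u i) u
    rw [h _ hlt, if_pos rfl, coeff_zero] at this
    exact mem_support_iff.mp hu this.symm
  · intro h k hk
    ext u
    rw [coeff_coeff_scaleHom, coeff_zero]
    split_ifs with hku
    · by_contra hne
      exact absurd (h u (mem_support_iff.mpr hne)) (by omega)
    · rfl

theorem monomial_mem_monomialPrimeIdeal_pow (F : Finset (Fin n)) (u : Fin n →₀ ℕ) (c : K) :
    monomial u c ∈ monomialPrimeIdeal K F ^ ∑ i ∈ F, u i := by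
  classical
  rw [monomial_eq, Finsupp.prod_fintype _ _ (by simp),
    ← Finset.prod_mul_prod_compl F, ← mul_assoc, mul_comm (C c), mul_assoc,
    ← Finset.prod_pow_eq_pow_sum]
  refine Ideal.mul_mem_right _ _ (Ideal.prod_mem_prod fun i hi => Ideal.pow_mem_pow ?_ _)
  exact Ideal.subset_span ⟨i, hi, rfl⟩

theorem mem_monomialPrimeIdeal_pow_iff_dvd (F : Finset (Fin n)) (f : MvPolynomial (Fin n) K)
    (d : ℕ) : f ∈ monomialPrimeIdeal K F ^ d ↔ Polynomial.X ^ d ∣ scaleHom K F f := by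
  constructor
  · intro hf
    have hle : monomialPrimeIdeal K F ≤
        (Ideal.span {Polynomial.X}).comap (scaleHom K F) := by
      refine Ideal.span_le.mpr ?_
      rintro _ ⟨i, hi, rfl⟩
      have : i ∈ F := hi
      simp [scaleHom, this, Ideal.mem_span_singleton]
    have := (Ideal.pow_right_mono hle d).trans (Ideal.le_comap_pow _ d) hf
    rwa [Ideal.mem_comap, Ideal.span_singleton_pow, Ideal.mem_span_singleton] at this
  · intro hf
    rw [X_pow_dvd_scaleHom_iff] at hf
    rw [f.as_sum]
    exact Ideal.sum_mem _ fun u hu =>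
      Ideal.pow_le_pow_right (hf u hu) (monomial_mem_monomialPrimeIdeal_pow F u _)

theorem mem_monomialPrimeIdeal_pow_iff (F : Finset (Fin n)) (f : MvPolynomial (Fin n) K) (d : ℕ) :
    f ∈ monomialPrimeIdeal K F ^ d ↔ ∀ u ∈ f.support, d ≤ ∑ i ∈ F, u i := by
  rw [mem_monomialPrimeIdeal_pow_iff_dvd, X_pow_dvd_scaleHom_iff]

theorem mem_monomialPrimeIdeal_iff_dvd (F : Finset (Fin n)) (f : MvPolynomial (Fin n) K) :
    f ∈ monomialPrimeIdeal K F ↔ Polynomial.X ∣ scaleHom K F f := by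
  simpa using mem_monomialPrimeIdeal_pow_iff_dvd F f 1

theorem mem_monomialPrimeIdeal_iff (F : Finset (Fin n)) (f : MvPolynomial (Fin n) K) :
    f ∈ monomialPrimeIdeal K F ↔ ∀ u ∈ f.support, ∃ i ∈ F, u i ≠ 0 :=
  mem_ideal_span_X_image

theorem isPrime_monomialPrimeIdeal (F : Finset (Fin n)) :
    (monomialPrimeIdeal K F).IsPrime := by
  have h : monomialPrimeIdeal K F = (Ideal.span {Polynomial.X}).comap (scaleHom K F) := by
    ext f
    rw [mem_monomialPrimeIdeal_iff_dvd, Ideal.mem_comap, Ideal.mem_span_singleton]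
  rw [h]
  have : (Ideal.span {(Polynomial.X : Polynomial (MvPolynomial (Fin n) K))}).IsPrime :=
    (Ideal.span_singleton_prime Polynomial.X_ne_zero).mpr Polynomial.prime_X
  exact Ideal.comap_isPrime _ _

theorem mem_of_mul_mem_monomialPrimeIdeal_pow {F : Finset (Fin n)} {s f : MvPolynomial (Fin n) K}
    {d : ℕ} (h : s * f ∈ monomialPrimeIdeal K F ^ d) (hf : f ∉ monomialPrimeIdeal K F ^ d) :
    s ∈ monomialPrimeIdeal K F := by
  rw [mem_monomialPrimeIdeal_pow_iff_dvd] at h hf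
  rw [mem_monomialPrimeIdeal_iff_dvd]
  by_contra hs
  rw [map_mul] at h
  exact hf (Polynomial.prime_X.pow_dvd_of_dvd_mul_left d hs h)

theorem monomialPrimeIdeal_univ : monomialPrimeIdeal K (Finset.univ : Finset (Fin n)) =
    maxIdeal K (Fin n) := by
  simp [monomialPrimeIdeal, maxIdeal]

end MonomialPrimes

section AssociatedPrimes

theorem mem_associatedPrimes_quotient_iff {R : Type*} [CommRing R] [IsNoetherianRing R]
    {J P : Ideal R} :
    P ∈ associatedPrimes R (R ⧸ J) ↔ P.IsPrime ∧ ∃ f : R, ∀ s, s ∈ P ↔ s * f ∈ J := by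
  rw [AssociatedPrimes.mem_iff, IsAssociatedPrime, Submodule.isAssociatedPrime_iff]
  refine and_congr_right fun _ => ?_
  have key : ∀ f s : R, s ∈ (⊥ : Submodule R (R ⧸ J)).colon {Ideal.Quotient.mk J f} ↔
      s * f ∈ J := fun f s => by
    rw [Submodule.mem_colon_singleton, Submodule.mem_bot, ← Ideal.Quotient.eq_zero_iff_mem,
      map_mul, Algebra.smul_def]
    rfl
  constructor
  · rintro ⟨x, rfl⟩
    obtain ⟨f, rfl⟩ := Ideal.Quotient.mk_surjective x
    exact ⟨f, key f⟩
  · rintro ⟨f, hf⟩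
    exact ⟨Ideal.Quotient.mk J f, Ideal.ext fun s => (hf s).trans (key f s).symm⟩

variable {K} {n : ℕ}

theorem eq_monomialPrimeIdeal_of_mem_associatedPrimes {J P : Ideal (MvPolynomial (Fin n) K)}
    {r : ℕ} {F : Fin r → Finset (Fin n)} {d : Fin r → ℕ}
    (hJ : J = ⨅ i, monomialPrimeIdeal K (F i) ^ d i)
    (hP : P ∈ associatedPrimes (MvPolynomial (Fin n) K) (MvPolynomial (Fin n) K ⧸ J)) :
    ∃ i, P = monomialPrimeIdeal K (F i) := by
  classical
  obtain ⟨hprime, f, hf⟩ := mem_associatedPrimes_quotient_iff.mp hP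
  have hle : (Finset.univ.filter fun i => f ∉ monomialPrimeIdeal K (F i) ^ d i).inf
      (fun i => monomialPrimeIdeal K (F i) ^ d i) ≤ P := by
    intro s hs
    rw [hf, hJ, Ideal.mem_iInf]
    intro i
    by_cases hi : f ∈ monomialPrimeIdeal K (F i) ^ d i
    · exact Ideal.mul_mem_left _ _ hi
    · exact Ideal.mul_mem_right _ _ (Finset.inf_le (f := fun i => monomialPrimeIdeal K (F i) ^ d i)
        (Finset.mem_filter.mpr ⟨Finset.mem_univ i, hi⟩) hs)
  obtain ⟨i, hi, hiP⟩ := (Ideal.IsPrime.inf_le' hprime).mp hle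
  refine ⟨i, le_antisymm (fun s hs => ?_) (hprime.le_of_pow_le hiP)⟩
  have hsf := (hf s).mp hs
  rw [hJ, Ideal.mem_iInf] at hsf
  exact mem_of_mul_mem_monomialPrimeIdeal_pow (hsf i) (Finset.mem_filter.mp hi).2

/-- A monomial ideal, described by its exponents `E`, has the associated prime `p_F` if `p_F` is
the colon ideal by a monomial. -/
theorem monomialPrimeIdeal_mem_associatedPrimes {J : Ideal (MvPolynomial (Fin n) K)}
    {E : (Fin n →₀ ℕ) → Prop} (hJ : ∀ f, f ∈ J ↔ ∀ u ∈ f.support, E u)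
    {F : Finset (Fin n)} {h : Fin n →₀ ℕ} (hF : ∀ i ∈ F, E (Finsupp.single i 1 + h))
    (hE : ∀ u : Fin n →₀ ℕ, (∀ i ∈ F, u i = 0) → ¬ E (u + h)) :
    monomialPrimeIdeal K F ∈
      associatedPrimes (MvPolynomial (Fin n) K) (MvPolynomial (Fin n) K ⧸ J) := by
  refine mem_associatedPrimes_quotient_iff.mpr
    ⟨isPrime_monomialPrimeIdeal F, monomial h 1, fun s => ⟨fun hs => ?_, fun hs => ?_⟩⟩
  · have hle : monomialPrimeIdeal K F ≤ J.colon {monomial h 1} := by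
      refine Ideal.span_le.mpr ?_
      rintro _ ⟨i, hi, rfl⟩
      rw [SetLike.mem_coe, Submodule.mem_colon_singleton, smul_eq_mul, hJ]
      intro u hu
      change u ∈ (X i * monomial h (1 : K)).support at hu
      rw [← pow_one (X i), X_pow_eq_monomial, monomial_mul, one_mul] at hu
      rw [Finset.mem_singleton.mp (support_monomial_subset hu)]
      exact hF i hi
    exact Submodule.mem_colon_singleton.mp (hle hs)
  · rw [mem_monomialPrimeIdeal_iff]
    intro u hu
    by_contra! hu0
    refine hE u hu0 ((hJ _).mp hs _ ?_)
    rw [mem_support_iff, coeff_mul_monomial, mul_one]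
    exact mem_support_iff.mp hu

end AssociatedPrimes

section EdgeIdeal

variable {n : ℕ} (G : SimpleGraph (Fin n))

/-- The exponents of the monomials in the edge ideal of `G`. -/
def DvdByEdge (u : Fin n →₀ ℕ) : Prop :=
  ∃ i j, G.Adj i j ∧ u i ≠ 0 ∧ u j ≠ 0

/-- The exponents of the monomials in the square of the edge ideal of `G`. -/
def DvdByTwoEdges (u : Fin n →₀ ℕ) : Prop :=
  ∃ i j k l, G.Adj i j ∧ G.Adj k l ∧
    Finsupp.single i 1 + Finsupp.single j 1 + (Finsupp.single k 1 + Finsupp.single l 1) ≤ u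

variable {G}

theorem edgeIdeal_eq_span_monomial : edgeIdeal K G = Ideal.span ((fun u => monomial u (1 : K)) ''
    {u | ∃ i j, G.Adj i j ∧ u = Finsupp.single i 1 + Finsupp.single j 1}) := by
  rw [edgeIdeal]
  congr 1
  ext f
  have hX : ∀ i j : Fin n, (X i * X j : MvPolynomial (Fin n) K) =
      monomial (Finsupp.single i 1 + Finsupp.single j 1) 1 := fun i j => by
    rw [X, X, monomial_mul, one_mul]
  simp only [Set.mem_ofPred_eq, Set.mem_image, hX]
  constructor
  · rintro ⟨i, j, hij, rfl⟩
    exact ⟨_, ⟨i, j, hij, rfl⟩, rfl⟩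
  · rintro ⟨_, ⟨i, j, hij, rfl⟩, rfl⟩
    exact ⟨i, j, hij, rfl⟩

theorem single_add_single_le_iff {i j : Fin n} (hij : i ≠ j) {u : Fin n →₀ ℕ} :
    Finsupp.single i 1 + Finsupp.single j 1 ≤ u ↔ u i ≠ 0 ∧ u j ≠ 0 := by
  rw [Finsupp.le_def]
  simp only [Finsupp.add_apply, Finsupp.single_apply]
  grind

theorem two_edges_le_iff {i j k l : Fin n} {u : Fin n →₀ ℕ} :
    Finsupp.single i 1 + Finsupp.single j 1 + (Finsupp.single k 1 + Finsupp.single l 1) ≤ u ↔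
      ∀ x, (if i = x then 1 else 0) + (if j = x then 1 else 0) +
        ((if k = x then 1 else 0) + (if l = x then 1 else 0)) ≤ u x := by
  simp only [Finsupp.le_def, Finsupp.add_apply, Finsupp.single_apply]

theorem mem_edgeIdeal_iff (f : MvPolynomial (Fin n) K) :
    f ∈ edgeIdeal K G ↔ ∀ u ∈ f.support, DvdByEdge G u := by
  rw [edgeIdeal_eq_span_monomial, mem_ideal_span_monomial_image]
  refine forall₂_congr fun u _ => ⟨?_, ?_⟩
  · rintro ⟨_, ⟨i, j, hij, rfl⟩, hle⟩
    exact ⟨i, j, hij, (single_add_single_le_iff hij.ne).mp hle⟩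
  · rintro ⟨i, j, hij, hu⟩
    exact ⟨_, ⟨i, j, hij, rfl⟩, (single_add_single_le_iff hij.ne).mpr hu⟩

open scoped Pointwise in
theorem mem_edgeIdeal_sq_iff (f : MvPolynomial (Fin n) K) :
    f ∈ edgeIdeal K G ^ 2 ↔ ∀ u ∈ f.support, DvdByTwoEdges G u := by
  have himage : ∀ A : Set (Fin n →₀ ℕ), ((fun u => monomial u (1 : K)) '' A) *
      ((fun u => monomial u (1 : K)) '' A) = (fun u => monomial u (1 : K)) '' (A + A) := by
    intro A
    refine (Set.image_image2_distrib fun u v => ?_).symm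
    rw [monomial_mul, one_mul]
  rw [pow_two, edgeIdeal_eq_span_monomial, Ideal.span_mul_span', himage,
    mem_ideal_span_monomial_image]
  refine forall₂_congr fun u _ => ⟨?_, ?_⟩
  · rintro ⟨_, ⟨_, ⟨i, j, hij, rfl⟩, _, ⟨k, l, hkl, rfl⟩, rfl⟩, hle⟩
    exact ⟨i, j, k, l, hij, hkl, hle⟩
  · rintro ⟨i, j, k, l, hij, hkl, hle⟩
    exact ⟨_, ⟨_, ⟨i, j, hij, rfl⟩, _, ⟨k, l, hkl, rfl⟩, rfl⟩, hle⟩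

variable {K}

theorem monomial_mem_edgeIdeal_sq_iff {u : Fin n →₀ ℕ} :
    monomial u (1 : K) ∈ edgeIdeal K G ^ 2 ↔ DvdByTwoEdges G u := by
  classical
  rw [mem_edgeIdeal_sq_iff, support_monomial, if_neg one_ne_zero]
  simp

theorem DvdByTwoEdges.two_le_sum {u : Fin n →₀ ℕ} (hu : DvdByTwoEdges G u) {F : Finset (Fin n)}
    (hF : G.IsVertexCover (F : Set (Fin n))) : 2 ≤ ∑ x ∈ F, u x := by
  obtain ⟨i, j, k, l, hij, hkl, hle⟩ := hu
  refine le_trans ?_ (Finset.sum_le_sum fun x _ => hle x)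
  simp only [Finsupp.add_apply, Finset.sum_add_distrib, Finsupp.single_apply, Finset.sum_ite_eq]
  have h1 := hF hij
  have h2 := hF hkl
  simp only [Finset.mem_coe] at h1 h2
  split_ifs <;> simp_all

theorem DvdByTwoEdges.four_le_sum {u : Fin n →₀ ℕ} (hu : DvdByTwoEdges G u) :
    4 ≤ ∑ x, u x := by
  obtain ⟨i, j, k, l, -, -, hle⟩ := hu
  refine le_trans ?_ (Finset.sum_le_sum fun x _ => hle x)
  simp [Finset.sum_add_distrib, Finsupp.single_apply]

/-- A monomial of order at least two along every vertex cover is divisible by two edges or by a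
triangle. -/
theorem dvdByTwoEdges_or_exists_threeCycle {u : Fin n →₀ ℕ}
    (hu : ∀ F : Finset (Fin n), G.IsVertexCover (F : Set (Fin n)) → 2 ≤ ∑ x ∈ F, u x) :
    DvdByTwoEdges G u ∨ ∃ i j l, IsThreeCycle G i j l ∧ u i ≠ 0 ∧ u j ≠ 0 ∧ u l ≠ 0 := by
  classical
  have hedge : ∃ a b, G.Adj a b ∧ u a ≠ 0 ∧ u b ≠ 0 := by
    by_contra! hno
    have := hu (Finset.univ.filter fun x => u x = 0) fun v w hvw => by
      simpa [or_iff_not_imp_left] using hno v w hvw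
    rw [Finset.sum_eq_zero fun x hx => (Finset.mem_filter.mp hx).2] at this
    omega
  have havoid : ∀ a, 2 ≤ u a ∨
      ∃ c d, G.Adj c d ∧ u c ≠ 0 ∧ u d ≠ 0 ∧ c ≠ a ∧ d ≠ a := by
    intro a
    by_contra! hno
    have := hu (Finset.univ.filter fun x => u x = 0 ∨ x = a) fun v w hvw => by
      have := hno.2 v w hvw
      simp only [Finset.coe_filter, Set.mem_ofPred_eq, Finset.mem_univ, true_and]
      tauto
    rw [Finset.sum_eq_single a (fun x hx hxa => by simpa [hxa] using hx) (by simp)] at this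
    omega
  obtain ⟨a, b, hab, ha, hb⟩ := hedge
  by_contra! hno
  obtain ⟨hsq, htri⟩ := hno
  have htwo : ∀ i j k l, G.Adj i j → G.Adj k l → ¬ ∀ x, (if i = x then 1 else 0) +
      (if j = x then 1 else 0) + ((if k = x then 1 else 0) + (if l = x then 1 else 0)) ≤ u x :=
    fun i j k l hij hkl h => hsq ⟨i, j, k, l, hij, hkl, two_edges_le_iff.mpr h⟩
  have hthree : ∀ i j l, G.Adj i j → G.Adj j l → G.Adj i l → u i ≠ 0 → u j ≠ 0 → u l = 0 :=
    fun i j l hij hjl hil => htri i j l ⟨hij, hjl, hil⟩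
  -- An edge avoiding an endpoint of `ab` passes through the other endpoint.
  have hthrough : ∀ a b, G.Adj a b → u a ≠ 0 → u b ≠ 0 →
      2 ≤ u a ∨ ∃ d, G.Adj b d ∧ u d ≠ 0 ∧ d ≠ a := by
    intro a b hab ha hb
    refine (havoid a).imp_right ?_
    rintro ⟨c, d, hcd, hc, hd, hca, hda⟩
    by_cases hcb : c = b
    · exact ⟨d, hcb ▸ hcd, hd, hda⟩
    · by_cases hdb : d = b
      · exact ⟨c, hdb ▸ hcd.symm, hc, hca⟩
      · refine absurd ?_ (htwo a b c d hab hcd)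
        have := hab.ne
        have := hcd.ne
        grind
  have hne := hab.ne
  rcases hthrough a b hab ha hb with h2a | ⟨d, hbd, hd, hda⟩ <;>
    rcases hthrough b a hab.symm hb ha with h2b | ⟨c, hac, hc, hcb⟩
  · exact htwo a b a b hab hab (by grind)
  · exact htwo a b a c hab hac (by have := hac.ne; grind)
  · exact htwo a b b d hab hbd (by have := hbd.ne; grind)
  · have h1 := hbd.ne
    have h2 := hac.ne
    by_cases hcd : c = d
    · subst hcd
      exact hc (hthree a b c hab hbd hac ha hb)
    · exact htwo b d a c hbd hac (by grind)

theorem dvdByTwoEdges_of_central (hcentral : ∀ i j l : Fin n, IsThreeCycle G i j l →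
    IsCentralThreeCycle G i j l) {u : Fin n →₀ ℕ}
    (hu : ∀ F : Finset (Fin n), G.IsVertexCover (F : Set (Fin n)) → 2 ≤ ∑ x ∈ F, u x)
    (hdeg : 4 ≤ ∑ x, u x) : DvdByTwoEdges G u := by
  rcases dvdByTwoEdges_or_exists_threeCycle hu with h | ⟨i, j, l, hijl, hi, hj, hl⟩
  · exact h
  obtain ⟨hij, hjl, hil⟩ := hijl
  have hsum : ∑ x, (Finsupp.single i 1 + Finsupp.single j 1 + Finsupp.single l 1 :
      Fin n →₀ ℕ) x = 3 := by
    simp [Finset.sum_add_distrib, Finsupp.single_apply]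
  obtain ⟨v, -, hv⟩ := Finset.exists_lt_of_sum_lt (hsum.trans_lt hdeg)
  simp only [Finsupp.add_apply, Finsupp.single_apply] at hv
  have h1 := hij.ne
  have h2 := hjl.ne
  have h3 := hil.ne
  rcases (hcentral i j l ⟨hij, hjl, hil⟩).2 v with h | h | h <;> have h4 := h.ne
  · exact ⟨v, i, j, l, h, hjl, two_edges_le_iff.mpr (by grind)⟩
  · exact ⟨v, j, i, l, h, hil, two_edges_le_iff.mpr (by grind)⟩
  · exact ⟨v, l, i, j, h, hij, two_edges_le_iff.mpr (by grind)⟩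

theorem exists_iInf_eq_edgeIdeal_sq (hcentral : ∀ i j l : Fin n, IsThreeCycle G i j l →
    IsCentralThreeCycle G i j l) :
    ∃ (r : ℕ) (F : Fin r → Finset (Fin n)) (d : Fin r → ℕ), (∀ t, 0 < d t) ∧
      (∀ t, Minimal (fun F : Finset (Fin n) => G.IsVertexCover (F : Set (Fin n))) (F t) ∨
        F t = Finset.univ) ∧
      edgeIdeal K G ^ 2 = ⨅ t, monomialPrimeIdeal K (F t) ^ d t := by
  classical
  let T : Finset (Finset (Fin n) × ℕ) := insert (Finset.univ, 4)
    ((Finset.univ.filter fun F : Finset (Fin n) =>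
      Minimal (fun F : Finset (Fin n) => G.IsVertexCover (F : Set (Fin n))) F).image (·, 2))
  have hT : ∀ p, p ∈ T ↔ p = (Finset.univ, 4) ∨
      ∃ F, Minimal (fun F : Finset (Fin n) => G.IsVertexCover (F : Set (Fin n))) F ∧
        (F, 2) = p := by
    simp [T]
  refine ⟨T.card, fun t => (T.equivFin.symm t).1.1, fun t => (T.equivFin.symm t).1.2,
    fun t => ?_, fun t => ?_, ?_⟩
  · rcases (hT _).mp (T.equivFin.symm t).2 with h | ⟨F, -, h⟩
    · simp [h]
    · simp [← h]
  · rcases (hT _).mp (T.equivFin.symm t).2 with h | ⟨F, hF, h⟩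
    · simp [h]
    · simp [← h, hF]
  rw [T.equivFin.symm.iInf_comp (g := fun p : T => monomialPrimeIdeal K p.1.1 ^ p.1.2)]
  ext f
  rw [Ideal.mem_iInf, mem_edgeIdeal_sq_iff]
  simp only [mem_monomialPrimeIdeal_pow_iff]
  constructor
  · rintro hf ⟨p, hp⟩ u hu
    rcases (hT p).mp hp with rfl | ⟨F, hF, rfl⟩
    · exact (hf u hu).four_le_sum
    · exact (hf u hu).two_le_sum hF.prop
  · intro hf u hu
    refine dvdByTwoEdges_of_central hcentral (fun F hF => ?_)
      (hf ⟨(Finset.univ, 4), (hT _).mpr (Or.inl rfl)⟩ u hu)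
    obtain ⟨F', hle, hF'⟩ := exists_minimal_le_of_wellFoundedLT
      (fun F : Finset (Fin n) => G.IsVertexCover (F : Set (Fin n))) F hF
    exact (hf ⟨(F', 2), (hT _).mpr (Or.inr ⟨F', hF', rfl⟩)⟩ u hu).trans
      (Finset.sum_le_sum_of_subset hle)

theorem monomialPrimeIdeal_mem_associatedPrimes_edgeIdeal {F : Finset (Fin n)}
    (hF : Minimal (fun F : Finset (Fin n) => G.IsVertexCover (F : Set (Fin n))) F) :
    monomialPrimeIdeal K F ∈
      associatedPrimes (MvPolynomial (Fin n) K) (MvPolynomial (Fin n) K ⧸ edgeIdeal K G) := by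
  classical
  refine monomialPrimeIdeal_mem_associatedPrimes (mem_edgeIdeal_iff K)
    (h := Finsupp.equivFunOnFinite.symm fun x => if x ∈ F then 0 else 1) (fun i hi => ?_) ?_
  · have hnot : ¬ G.IsVertexCover ((F.erase i : Finset (Fin n)) : Set (Fin n)) := fun hc =>
      Finset.notMem_erase i F (hF.le_of_le hc (Finset.erase_subset i F) hi)
    simp only [SimpleGraph.IsVertexCover, not_forall, not_or, Finset.mem_coe,
      Finset.mem_erase, not_and_or, not_not] at hnot
    obtain ⟨v, w, hvw, hv, hw⟩ := hnot
    refine ⟨v, w, hvw, ?_, ?_⟩ <;>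
      simp only [Finsupp.add_apply, Finsupp.single_apply,
        Finsupp.equivFunOnFinite_symm_apply_apply] <;>
      grind
  · rintro u hu ⟨i, j, hij, hi, hj⟩
    have := hF.prop hij
    simp only [Finsupp.add_apply, Finsupp.equivFunOnFinite_symm_apply_apply, Finset.mem_coe] at *
    grind

theorem associatedPrimes_edgeIdeal_sq_subset (hcentral : ∀ i j l : Fin n, IsThreeCycle G i j l →
    IsCentralThreeCycle G i j l) :
    associatedPrimes (MvPolynomial (Fin n) K) (MvPolynomial (Fin n) K ⧸ edgeIdeal K G ^ 2) ⊆
      associatedPrimes (MvPolynomial (Fin n) K) (MvPolynomial (Fin n) K ⧸ edgeIdeal K G) ∪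
        {maxIdeal K (Fin n)} := by
  intro P hP
  obtain ⟨r, F, d, -, hF, hI⟩ := exists_iInf_eq_edgeIdeal_sq (K := K) hcentral
  obtain ⟨t, rfl⟩ := eq_monomialPrimeIdeal_of_mem_associatedPrimes hI hP
  refine (hF t).imp monomialPrimeIdeal_mem_associatedPrimes_edgeIdeal fun h => ?_
  rw [h, monomialPrimeIdeal_univ]
  rfl

theorem isCentralThreeCycle_of_isIntersectionType (hiso : ∀ v : Fin n, ∃ w : Fin n, G.Adj v w)
    (hI : IsIntersectionType K (edgeIdeal K G ^ 2)) {i j l : Fin n} (hijl : IsThreeCycle G i j l) :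
    IsCentralThreeCycle G i j l := by
  classical
  refine ⟨hijl, fun v => ?_⟩
  by_contra! hv
  obtain ⟨r, F, d, hd, hI⟩ := hI
  obtain ⟨hij, hjl, hil⟩ := hijl
  have hle : ∀ t, ∀ u : Fin n →₀ ℕ, DvdByTwoEdges G u → d t ≤ ∑ x ∈ F t, u x := by
    intro t u hu
    rw [← monomial_mem_edgeIdeal_sq_iff (K := K), hI, Ideal.mem_iInf] at hu
    exact (mem_monomialPrimeIdeal_pow_iff _ _ _).mp (hu t) u (by simp [mem_support_iff])
  have hedge : ∀ t a b, G.Adj a b → d t ≤ (if a ∈ F t then 2 else 0) +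
      if b ∈ F t then 2 else 0 := by
    intro t a b hab
    refine (hle t (Finsupp.single a 2 + Finsupp.single b 2)
      ⟨a, b, a, b, hab, hab, two_edges_le_iff.mpr fun x => ?_⟩).trans_eq ?_
    · simp only [Finsupp.add_apply, Finsupp.single_apply]
      grind
    · simp [Finset.sum_add_distrib, Finsupp.single_apply]
  let u : Fin n →₀ ℕ := Finsupp.single i 1 + Finsupp.single j 1 + Finsupp.single l 1 +
    Finsupp.single v (∑ t, d t)
  have hu : ¬ DvdByTwoEdges G u := by
    rintro ⟨a, b, a', b', hab, hab', hle⟩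
    rw [two_edges_le_iff] at hle
    simp only [u, Finsupp.add_apply, Finsupp.single_apply] at hle
    have hmem : ∀ x y, G.Adj x y → (x = v ∨ x = i ∨ x = j ∨ x = l) →
        (y = v ∨ y = i ∨ y = j ∨ y = l) → x ≠ v := by
      rintro x y hxy hx hy rfl
      rcases hy with rfl | rfl | rfl | rfl <;> simp_all
    have h1 := hle a
    have h2 := hle b
    have h3 := hle a'
    have h4 := hle b'
    have h5 := hmem a b hab
    have h6 := hmem b a hab.symm
    have h7 := hmem a' b' hab'
    have h8 := hmem b' a' hab'.symm
    have h9 := hab.ne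
    have h10 := hab'.ne
    have h11 := hij.ne
    have h12 := hjl.ne
    have h13 := hil.ne
    clear hle hmem
    grind
  rw [← monomial_mem_edgeIdeal_sq_iff (K := K), hI, Ideal.mem_iInf] at hu
  push Not at hu
  obtain ⟨t, ht⟩ := hu
  rw [mem_monomialPrimeIdeal_pow_iff, support_monomial, if_neg one_ne_zero] at ht
  simp only [Finset.mem_singleton, forall_eq, not_le, u, Finsupp.add_apply, Finsupp.single_apply,
    Finset.sum_add_distrib, Finset.sum_ite_eq] at ht
  obtain ⟨w, hvw⟩ := hiso v
  have h1 := hedge t v w hvw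
  have h2 := hedge t i j hij
  have h3 := hedge t j l hjl
  have h4 := hedge t i l hil
  have h5 := hd t
  have h6 : d t ≤ ∑ t, d t := Finset.single_le_sum (fun _ _ => Nat.zero_le _) (Finset.mem_univ t)
  grind

theorem isCentralThreeCycle_of_associatedPrimes_subset
    (hass : associatedPrimes (MvPolynomial (Fin n) K)
        (MvPolynomial (Fin n) K ⧸ edgeIdeal K G ^ 2) ⊆
      associatedPrimes (MvPolynomial (Fin n) K) (MvPolynomial (Fin n) K ⧸ edgeIdeal K G) ∪
        {maxIdeal K (Fin n)}) {i j l : Fin n} (hijl : IsThreeCycle G i j l) :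
    IsCentralThreeCycle G i j l := by
  classical
  refine ⟨hijl, fun v => ?_⟩
  by_contra! hv
  obtain ⟨hij, hjl, hil⟩ := hijl
  -- A maximal independent set containing `v` among the vertices far from the triangle.
  obtain ⟨A, hvA, hA⟩ := Finite.exists_le_maximal
    (p := fun A : Finset (Fin n) => (∀ a ∈ A, ¬ G.Adj a i ∧ ¬ G.Adj a j ∧ ¬ G.Adj a l) ∧
      ∀ a ∈ A, ∀ b ∈ A, ¬ G.Adj a b) (a := {v}) (by simpa using hv)
  have hvA : v ∈ A := hvA (Finset.mem_singleton_self v)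
  obtain ⟨hfar, hindep⟩ := hA.prop
  have hnear : ∀ w, w ∉ A → G.Adj w i ∨ G.Adj w j ∨ G.Adj w l ∨ ∃ a ∈ A, G.Adj w a := by
    intro w hw
    by_contra! hno
    refine hw (hA.le_of_ge (y := insert w A) ⟨?_, ?_⟩ (Finset.subset_insert w A)
      (Finset.mem_insert_self w A))
    · intro a ha
      rcases Finset.mem_insert.mp ha with rfl | ha
      · exact ⟨hno.1, hno.2.1, hno.2.2.1⟩
      · exact hfar a ha
    · intro a ha b hb
      rcases Finset.mem_insert.mp ha with rfl | haA <;>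
        rcases Finset.mem_insert.mp hb with rfl | hbA
      · exact G.loopless.irrefl _
      · exact hno.2.2.2 b hbA
      · exact fun h => hno.2.2.2 a haA h.symm
      · exact hindep a haA b hbA
  have hiA : i ∉ A := fun h => (hfar i h).2.1 hij
  have hjA : j ∉ A := fun h => (hfar j h).1 hij.symm
  have hlA : l ∉ A := fun h => (hfar l h).1 hil.symm
  have h1 := hij.ne
  have h2 := hjl.ne
  have h3 := hil.ne
  have hmem : monomialPrimeIdeal K Aᶜ ∈ associatedPrimes (MvPolynomial (Fin n) K)
      (MvPolynomial (Fin n) K ⧸ edgeIdeal K G ^ 2) := by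
    refine monomialPrimeIdeal_mem_associatedPrimes (mem_edgeIdeal_sq_iff K)
      (h := Finsupp.equivFunOnFinite.symm fun x =>
        if x ∈ A ∨ x = i ∨ x = j ∨ x = l then 1 else 0) (fun w hw => ?_) ?_
    · rcases hnear w (Finset.mem_compl.mp hw) with h | h | h | ⟨a, ha, h⟩
      · refine ⟨w, i, j, l, h, hjl, two_edges_le_iff.mpr fun x => ?_⟩
        have := h.ne
        simp only [Finsupp.add_apply, Finsupp.single_apply,
          Finsupp.equivFunOnFinite_symm_apply_apply]
        grind
      · refine ⟨w, j, i, l, h, hil, two_edges_le_iff.mpr fun x => ?_⟩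
        have := h.ne
        simp only [Finsupp.add_apply, Finsupp.single_apply,
          Finsupp.equivFunOnFinite_symm_apply_apply]
        grind
      · refine ⟨w, l, i, j, h, hij, two_edges_le_iff.mpr fun x => ?_⟩
        have := h.ne
        simp only [Finsupp.add_apply, Finsupp.single_apply,
          Finsupp.equivFunOnFinite_symm_apply_apply]
        grind
      · refine ⟨w, a, i, j, h, hij, two_edges_le_iff.mpr fun x => ?_⟩
        have := h.ne
        simp only [Finsupp.add_apply, Finsupp.single_apply,
          Finsupp.equivFunOnFinite_symm_apply_apply]
        grind
    · rintro u hu ⟨a, b, a', b', hab, hab', hle⟩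
      rw [two_edges_le_iff] at hle
      simp only [Finsupp.add_apply, Finsupp.equivFunOnFinite_symm_apply_apply] at hle
      have hu : ∀ x, x ∉ A → u x = 0 := fun x hx => hu x (Finset.mem_compl.mpr hx)
      have hout : ∀ x y, G.Adj x y → (x ∈ A ∨ x = i ∨ x = j ∨ x = l) →
          (y ∈ A ∨ y = i ∨ y = j ∨ y = l) → x ∉ A := by
        rintro x y hxy - hy hx
        rcases hy with hy | rfl | rfl | rfl
        · exact hindep x hx y hy hxy
        · exact (hfar x hx).1 hxy
        · exact (hfar x hx).2.1 hxy
        · exact (hfar x hx).2.2 hxy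
      have h4 := hle a
      have h5 := hle b
      have h6 := hle a'
      have h7 := hle b'
      have h8 := hout a b hab
      have h9 := hout b a hab.symm
      have h10 := hout a' b' hab'
      have h11 := hout b' a' hab'.symm
      have h12 := hab.ne
      have h13 := hab'.ne
      have h14 := hu a
      have h15 := hu b
      have h16 := hu a'
      have h17 := hu b'
      clear hle hout hu hnear hindep hfar hA hass
      grind
  rcases hass hmem with h | h
  · obtain ⟨hprime, f, hf⟩ := mem_associatedPrimes_quotient_iff.mp h
    have hf1 : f ∉ edgeIdeal K G := fun hfI =>
      hprime.one_notMem ((hf 1).mpr (by rwa [one_mul]))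
    rw [mem_edgeIdeal_iff] at hf1
    push Not at hf1
    obtain ⟨u, hu, huE⟩ := hf1
    have hmul : ∀ x, x ∉ A → DvdByEdge G (Finsupp.single x 1 + u) := by
      intro x hx
      refine (mem_edgeIdeal_iff K _).mp ((hf (X x)).mp (Ideal.subset_span
        ⟨x, by simpa using hx, rfl⟩)) _ ?_
      rw [mem_support_iff, coeff_X_mul]
      exact mem_support_iff.mp hu
    obtain ⟨w, hw, hiw⟩ : ∃ w, u w ≠ 0 ∧ G.Adj i w := by
      obtain ⟨a, b, hab, ha, hb⟩ := hmul i hiA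
      simp only [Finsupp.add_apply, Finsupp.single_apply] at ha hb
      by_contra! hno
      refine huE ⟨a, b, hab, ?_, ?_⟩
      · rintro ha0
        have : i = a := by grind
        subst this
        exact hno b (by have := hab.ne; grind) hab
      · rintro hb0
        have : i = b := by grind
        subst this
        exact hno a (by have := hab.ne; grind) hab.symm
    obtain ⟨a, b, hab, ha, hb⟩ := hmul w fun hwA => (hfar w hwA).1 hiw.symm
    simp only [Finsupp.add_apply, Finsupp.single_apply] at ha hb
    exact huE ⟨a, b, hab, by grind, by grind⟩
  · have hX : (X v : MvPolynomial (Fin n) K) ∈ monomialPrimeIdeal K Aᶜ := by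
      rw [Set.mem_singleton_iff.mp h]
      exact Ideal.subset_span ⟨v, rfl⟩
    rw [mem_monomialPrimeIdeal_iff, support_X] at hX
    obtain ⟨x, hx, hx0⟩ := hX _ (Finset.mem_singleton_self _)
    rw [Finsupp.single_apply] at hx0
    have : v = x := by grind
    subst this
    exact Finset.mem_compl.mp hx hvA

end EdgeIdeal

/-- For the edge ideal `I = I(G)` of a graph `G` on `[n]` without
isolated vertices the following are equivalent: (a) `I²` is of intersection type;
(b) `Ass(S/I²) ⊆ Ass(S/I) ∪ {m}`; (c) every 3-cycle of `G` is central. -/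
theorem square_edge_ideal_intersection_type_iff {n : ℕ} (G : SimpleGraph (Fin n))
    (hiso : ∀ v : Fin n, ∃ w : Fin n, G.Adj v w)
    (I : Ideal (MvPolynomial (Fin n) K)) (hI : I = edgeIdeal K G) :
    (IsIntersectionType K (I ^ 2) ↔
      associatedPrimes (MvPolynomial (Fin n) K) (MvPolynomial (Fin n) K ⧸ (I ^ 2)) ⊆
        associatedPrimes (MvPolynomial (Fin n) K) (MvPolynomial (Fin n) K ⧸ I) ∪
          {maxIdeal K (Fin n)}) ∧
    ((associatedPrimes (MvPolynomial (Fin n) K) (MvPolynomial (Fin n) K ⧸ (I ^ 2)) ⊆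
        associatedPrimes (MvPolynomial (Fin n) K) (MvPolynomial (Fin n) K ⧸ I) ∪
          {maxIdeal K (Fin n)}) ↔
      ∀ i j l : Fin n, IsThreeCycle G i j l → IsCentralThreeCycle G i j l) := by

  subst hI
  have hca : (∀ i j l : Fin n, IsThreeCycle G i j l → IsCentralThreeCycle G i j l) →
      IsIntersectionType K (edgeIdeal K G ^ 2) := fun h => by
    obtain ⟨r, F, d, hd, -, hI⟩ := exists_iInf_eq_edgeIdeal_sq (K := K) h
    exact ⟨r, F, d, hd, hI⟩
  have hbc := fun h i j l =>
    isCentralThreeCycle_of_associatedPrimes_subset (K := K) (G := G) h (i := i) (j := j) (l := l)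
  exact ⟨⟨fun h => associatedPrimes_edgeIdeal_sq_subset fun i j l =>
    isCentralThreeCycle_of_isIntersectionType hiso h, fun h => hca (hbc h)⟩,
    hbc, associatedPrimes_edgeIdeal_sq_subset⟩

end
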